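/- arXiv:1412.4461 — 8 statements merged into one kernel-verified Lean document; each statement's English description precedes it below -/
import Mathlib

section
/- Let n ≥ 1 and let A be an ℝ-subalgebra of E(ℝⁿ) that contains every real-analytic function ℝⁿ → ℝ. Let a be an ideal of A and let â be the ideal of E(ℝⁿ) generated by the elements of a. Then √[Ł]a = √[Ł]â ∩ A; that is, for every g ∈ A, there exist f ∈ a and an integer m ≥ 1 with f(x) − g(x)^(2m) ≥ 0 for all x ∈ ℝⁿ if and only if there exist F ∈ â and an integer m' ≥ 1 with F(x) − g(x)^(2m') ≥ 0 for all x ∈ ℝⁿ. (The ideal a is not assumed finitely generated.) -/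
/-- The ring `E(ℝⁿ)` of real-valued smooth (`C^∞`) functions on `ℝⁿ`,
as an `ℝ`-subalgebra of all functions `ℝⁿ → ℝ`. -/
def SmoothFns (n : ℕ) : Subalgebra ℝ ((Fin n → ℝ) → ℝ) where
  carrier := {f | ContDiff ℝ (⊤ : ℕ∞) f}
  mul_mem' := fun {a b} (hf : ContDiff ℝ (⊤ : ℕ∞) a) (hg : ContDiff ℝ (⊤ : ℕ∞) b) =>
    show ContDiff ℝ (⊤ : ℕ∞) (a * b) from hf.mul hg
  add_mem' := fun {a b} (hf : ContDiff ℝ (⊤ : ℕ∞) a) (hg : ContDiff ℝ (⊤ : ℕ∞) b) =>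
    show ContDiff ℝ (⊤ : ℕ∞) (a + b) from hf.add hg
  algebraMap_mem' := fun _r => show ContDiff ℝ (⊤ : ℕ∞) _ from contDiff_const

/-- A power series with nonnegative coefficients may grow arbitrarily fast: any sequence is
dominated, on consecutive unit intervals, by a real-analytic function. -/
theorem exists_analyticAt_ge_floor (M : ℕ → ℝ) :
    ∃ φ : ℝ → ℝ, (∀ t, AnalyticAt ℝ φ t) ∧ ∀ t, 0 ≤ t → M ⌊t⌋₊ ≤ φ t := by
  have hN : ∀ k : ℕ, ∃ N : ℕ, k ≤ N ∧ M k ≤ (((k : ℝ) + 2) / (k + 1)) ^ N := by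
    intro k
    have h1 : (1 : ℝ) < ((k : ℝ) + 2) / (k + 1) := by
      rw [one_lt_div (by positivity)]
      linarith
    obtain ⟨N, hN⟩ := pow_unbounded_of_one_lt (M k) h1
    exact ⟨max k N, le_max_left _ _,
      hN.le.trans (pow_le_pow_right₀ h1.le (le_max_right _ _))⟩
  choose N hkN hMN using hN
  have hsum : ∀ R : ℝ, 0 ≤ R → Summable fun k : ℕ => (R / ((k : ℝ) + 1)) ^ N k := by
    intro R hR
    refine Summable.of_norm_bounded_eventually_nat summable_geometric_two ?_
    filter_upwards [Filter.eventually_ge_atTop ⌈2 * R⌉₊] with k hk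
    have hk' : 2 * R ≤ k := (Nat.le_ceil _).trans (by exact_mod_cast hk)
    have h0 : 0 ≤ R / ((k : ℝ) + 1) := by positivity
    have h1 : R / ((k : ℝ) + 1) ≤ 1 / 2 := by
      rw [div_le_div_iff₀ (by positivity) (by norm_num)]
      linarith
    rw [Real.norm_of_nonneg (by positivity)]
    exact (pow_le_pow_left₀ h0 h1 _).trans
      (pow_le_pow_of_le_one (by norm_num) (by norm_num) (hkN k))
  let F : ℕ → ℂ → ℂ := fun k w => (w / ((k : ℂ) + 1)) ^ N k
  have hnorm : ∀ k w, ‖F k w‖ = (‖w‖ / ((k : ℝ) + 1)) ^ N k := by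
    intro k w
    have : ‖(k : ℂ) + 1‖ = (k : ℝ) + 1 := by
      exact_mod_cast Complex.norm_natCast (k + 1)
    simp only [F, norm_pow, norm_div, this]
  have hF : ∀ w, AnalyticAt ℂ (fun w => ∑' k, F k w) w := by
    intro w
    have hd : DifferentiableOn ℂ (fun w => ∑' k, F k w) (Metric.ball 0 (‖w‖ + 1)) := by
      refine Complex.differentiableOn_tsum_of_summable_norm
        (hsum (‖w‖ + 1) (by positivity)) (fun k => ?_) Metric.isOpen_ball fun k v hv => ?_
      · exact ((differentiable_id.div_const _).pow _).differentiableOn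
      · rw [hnorm]
        have : ‖v‖ ≤ ‖w‖ + 1 := (mem_ball_zero_iff.1 hv).le
        gcongr
    exact hd.analyticAt (Metric.isOpen_ball.mem_nhds (by simp))
  refine ⟨fun t => (∑' k, F k ((t : ℂ) + 2)).re, fun t => ?_, fun t ht => ?_⟩
  · have hin : AnalyticAt ℝ (fun t : ℝ => (t : ℂ) + 2) t :=
      (Complex.ofRealCLM.analyticAt t).add analyticAt_const
    have hmid : AnalyticAt ℝ (fun w => ∑' k, F k w) ((t : ℂ) + 2) := (hF _).restrictScalars
    exact (Complex.reCLM.analyticAt _).comp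
      (AnalyticAt.fun_comp (f := fun t : ℝ => (t : ℂ) + 2) hmid hin)
  · have hreal : ∀ k, F k ((t : ℂ) + 2) = (((t + 2) / ((k : ℝ) + 1)) ^ N k : ℝ) := by
      intro k
      simp [F]
    simp only [hreal]
    rw [← Complex.ofReal_tsum, Complex.ofReal_re]
    refine (hMN _).trans (le_trans ?_ ((hsum (t + 2) (by positivity)).le_tsum ⌊t⌋₊
      fun k _ => by positivity))
    have := Nat.floor_le ht
    gcongr

/-- Every continuous function on `ℝⁿ` is bounded above by a real-analytic function. -/
theorem Continuous.exists_analyticOn_ge {n : ℕ} {u : (Fin n → ℝ) → ℝ} (hu : Continuous u) :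
    ∃ h : (Fin n → ℝ) → ℝ, AnalyticOn ℝ h Set.univ ∧ ∀ x, u x ≤ h x := by
  have hM : ∀ k : ℕ, ∃ M : ℝ, ∀ x ∈ Metric.closedBall (0 : Fin n → ℝ) (k + 2), u x ≤ M := by
    intro k
    obtain ⟨M, hM⟩ := (isCompact_closedBall (0 : Fin n → ℝ) (k + 2)).bddAbove_image
      hu.continuousOn
    exact ⟨M, fun x hx => hM (Set.mem_image_of_mem u hx)⟩
  choose M hM using hM
  obtain ⟨φ, hφ, hMφ⟩ := exists_analyticAt_ge_floor M
  have hq : ∀ x : Fin n → ℝ, AnalyticAt ℝ (fun x : Fin n → ℝ => ∑ i, x i ^ 2) x := fun x =>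
    Finset.analyticAt_fun_sum _ fun i _ =>
      ((ContinuousLinearMap.proj (R := ℝ) (φ := fun _ : Fin n => ℝ) i).analyticAt x).pow 2
  refine ⟨fun x => φ (∑ i, x i ^ 2), fun x _ => ?_, fun x => ?_⟩
  · exact ((hφ _).fun_comp (hq x)).analyticWithinAt
  · refine (hM ⌊∑ i, x i ^ 2⌋₊ x ?_).trans (hMφ _ (by positivity))
    rw [mem_closedBall_zero_iff, pi_norm_le_iff_of_nonneg (by positivity)]
    intro i
    have h1 : x i ^ 2 ≤ ∑ j, x j ^ 2 :=
      Finset.single_le_sum (f := fun j => x j ^ 2) (fun j _ => sq_nonneg _) (Finset.mem_univ i)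
    have h2 := Nat.lt_floor_add_one (∑ j, x j ^ 2)
    rw [Real.norm_eq_abs]
    nlinarith [sq_abs (x i), sq_nonneg (|x i| - 1)]

/-- The square of an element of the extension of an ideal `a` of `A` to the ring of smooth
functions is bounded above by an element of `a`, if `A` contains all analytic functions. -/
theorem exists_mem_sq_le_of_mem_span {n : ℕ} {A : Subalgebra ℝ ((Fin n → ℝ) → ℝ)}
    (hA : A ≤ SmoothFns n)
    (hAnal : ∀ h : (Fin n → ℝ) → ℝ, AnalyticOn ℝ h Set.univ → h ∈ A)
    (a : Ideal A) {F : SmoothFns n}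
    (hF : F ∈ Ideal.span ((Subalgebra.inclusion hA) '' (a : Set A))) :
    ∃ f ∈ a, ∀ x, F.1 x ^ 2 ≤ f.1 x := by
  induction hF using Submodule.span_induction with
  | mem F hF =>
    obtain ⟨f, hf, rfl⟩ := hF
    exact ⟨f ^ 2, a.pow_mem_of_mem hf 2 two_pos, fun x => le_rfl⟩
  | zero => exact ⟨0, a.zero_mem, fun x => by simp⟩
  | add F G _ _ hF hG =>
    obtain ⟨f, hf, hFf⟩ := hF
    obtain ⟨g, hg, hGg⟩ := hG
    refine ⟨2 * (f + g), a.mul_mem_left _ (a.add_mem hf hg), fun x => ?_⟩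
    change (F.1 x + G.1 x) ^ 2 ≤ 2 * (f.1 x + g.1 x)
    linarith [hFf x, hGg x, add_sq_le (a := F.1 x) (b := G.1 x)]
  | smul h F _ hF =>
    obtain ⟨f, hf, hFf⟩ := hF
    have hc : Continuous h.1 := ContDiff.continuous (𝕜 := ℝ) (n := (⊤ : ℕ∞)) h.2
    obtain ⟨H, hH, hle⟩ := (hc.pow 2).exists_analyticOn_ge
    refine ⟨⟨H, hAnal H hH⟩ * f, a.mul_mem_left _ hf, fun x => ?_⟩
    change (h.1 x * F.1 x) ^ 2 ≤ H x * f.1 x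
    rw [mul_pow]
    exact mul_le_mul (hle x) (hFf x) (sq_nonneg _) ((sq_nonneg _).trans (hle x))

/-- Lemma (comparison of Łojasiewicz radicals): for any `ℝ`-subalgebra `A` of `E(ℝⁿ)`
containing all real-analytic functions, any ideal `a` of `A`, and `â` the ideal of
`E(ℝⁿ)` generated by the elements of `a`, one has `√[Ł]a = √[Ł]â ∩ A`. -/
theorem lojasiewicz_radical_smooth_extension (n : ℕ) (hn : 1 ≤ n)
    (A : Subalgebra ℝ ((Fin n → ℝ) → ℝ)) (hA : A ≤ SmoothFns n)
    (hAnal : ∀ h : (Fin n → ℝ) → ℝ, AnalyticOn ℝ h Set.univ → h ∈ A)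
    (a : Ideal A) (g : A) :
    (∃ f ∈ a, ∃ m : ℕ, 1 ≤ m ∧ ∀ x : Fin n → ℝ, f.1 x - g.1 x ^ (2 * m) ≥ 0) ↔
    (∃ F ∈ Ideal.span ((Subalgebra.inclusion hA) '' (a : Set A)),
      ∃ m : ℕ, 1 ≤ m ∧ ∀ x : Fin n → ℝ, F.1 x - g.1 x ^ (2 * m) ≥ 0) := by
  constructor
  · rintro ⟨f, hf, m, hm, h⟩
    exact ⟨Subalgebra.inclusion hA f, Ideal.subset_span (Set.mem_image_of_mem _ hf), m, hm, h⟩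
  · rintro ⟨F, hF, m, hm, h⟩
    obtain ⟨f, hf, hFf⟩ := exists_mem_sq_le_of_mem_span hA hAnal a hF
    refine ⟨f, hf, 2 * m, by omega, fun x => sub_nonneg.2 (le_trans ?_ (hFf x))⟩
    have h0 : 0 ≤ g.1 x ^ (2 * m) := (even_two_mul m).pow_nonneg _
    calc g.1 x ^ (2 * (2 * m)) = (g.1 x ^ (2 * m)) ^ 2 := by ring
      _ ≤ F.1 x ^ 2 := pow_le_pow_left₀ h0 (sub_nonneg.1 (h x)) 2
end

section
/- Let a ⊆ E(ℝⁿ) be a Łojasiewicz ideal generated by f₁,…,f_l and set f = f₁² + ⋯ + f_l². Let g ∈ E(ℝⁿ) be such that Z(g) ⊇ Z(f) = Z(a). Then for every compact set K ⊆ ℝⁿ there exist a constant c > 0 and a positive integer m such that g(x)^(2m) ≤ c·f(x) for all x in some open neighborhood of K. In particular, there exist a positive integer m and an element a₀ ∈ a such that g(x)^(2m) ≤ |a₀(x)| for all x in an open neighborhood of K. -/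
theorem SmoothFns.contDiff {n : ℕ} (h : SmoothFns n) : ContDiff ℝ (⊤ : ℕ∞) h.1 := h.2

theorem SmoothFns.sum_mul_apply {n l : ℕ} (G F : Fin l → SmoothFns n) (x : Fin n → ℝ) :
    (∑ i, G i * F i).1 x = ∑ i, (G i).1 x * (F i).1 x := by
  have h : (∑ i, G i * F i).1 = ∑ i, (G i).1 * (F i).1 :=
    map_sum (SmoothFns n).val (fun i => G i * F i) Finset.univ
  rw [h, Finset.sum_apply]
  rfl

/-- The zero set of a finitely generated ideal is the zero set of the sum of squares of its
generators. -/
theorem SmoothFns.sum_sq_eq_zero_iff {n l : ℕ} (F : Fin l → SmoothFns n) (x : Fin n → ℝ) :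
    (∑ i, F i * F i).1 x = 0 ↔ ∀ h ∈ Ideal.span (Set.range F), h.1 x = 0 := by
  rw [SmoothFns.sum_mul_apply,
    Finset.sum_eq_zero_iff_of_nonneg fun i _ => mul_self_nonneg ((F i).1 x)]
  constructor
  · intro hF h hh
    obtain ⟨G, rfl⟩ := Ideal.mem_span_range_iff_exists_fun.1 hh
    rw [SmoothFns.sum_mul_apply]
    exact Finset.sum_eq_zero fun i hi => by rw [mul_self_eq_zero.1 (hF i hi), mul_zero]
  · intro h i _
    rw [h (F i) (Ideal.subset_span ⟨i, rfl⟩), mul_zero]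

/-- On a compact set, the square of an element of a finitely generated ideal is bounded by a
multiple of the sum of squares of the generators. -/
theorem SmoothFns.exists_sq_le_mul_sum_sq {n l : ℕ} (F : Fin l → SmoothFns n) {h : SmoothFns n}
    (hh : h ∈ Ideal.span (Set.range F)) {K : Set (Fin n → ℝ)} (hK : IsCompact K) :
    ∃ M : ℝ, 0 < M ∧ ∀ x ∈ K, h.1 x ^ 2 ≤ M * (∑ i, F i * F i).1 x := by
  obtain ⟨G, rfl⟩ := Ideal.mem_span_range_iff_exists_fun.1 hh
  obtain ⟨M, hM⟩ := hK.bddAbove_image (f := (∑ i, G i * G i).1)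
    (SmoothFns.contDiff _).continuous.continuousOn
  refine ⟨max M 1, by positivity, fun x hx => ?_⟩
  have hMx : (∑ i, G i * G i).1 x ≤ max M 1 := (hM ⟨x, hx, rfl⟩).trans (le_max_left _ _)
  have hcs := Finset.sum_mul_sq_le_sq_mul_sq Finset.univ (fun i => (G i).1 x) (fun i => (F i).1 x)
  simp only [sq (_ : ℝ), SmoothFns.sum_mul_apply] at hcs hMx ⊢
  exact hcs.trans (mul_le_mul_of_nonneg_right hMx
    (Finset.sum_nonneg fun i _ => mul_self_nonneg _))

/-- On a bounded set, a smooth function vanishing on a nonempty closed set is bounded by a multiple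
of the distance to that set. -/
theorem SmoothFns.exists_abs_le_mul_infDist {n : ℕ} (g : SmoothFns n) {Z : Set (Fin n → ℝ)}
    (hZ : IsClosed Z) (hne : Z.Nonempty) (hg : ∀ z ∈ Z, g.1 z = 0) (R : ℝ) :
    ∃ C : ℝ, 0 < C ∧ ∀ x ∈ Metric.ball (0 : Fin n → ℝ) R, |g.1 x| ≤ C * Metric.infDist x Z := by
  obtain ⟨z₀, hz₀⟩ := hne
  set B := Metric.closedBall (0 : Fin n → ℝ) (R + R + dist z₀ 0)
  obtain ⟨C, hC⟩ := (SmoothFns.contDiff g).contDiffOn.exists_lipschitzOnWith (s := B) (by simp)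
    (convex_closedBall _ _) (isCompact_closedBall _ _)
  refine ⟨C + 1, by positivity, fun x hx => ?_⟩
  rw [Metric.mem_ball] at hx
  obtain ⟨z, hz, hxz⟩ := hZ.exists_infDist_eq_dist ⟨z₀, hz₀⟩ x
  have hle : dist x z ≤ dist x z₀ := hxz ▸ Metric.infDist_le_dist_of_mem hz₀
  have hd₀ : dist x z₀ ≤ dist x 0 + dist z₀ 0 := dist_triangle_right _ _ _
  have hdz : dist z 0 ≤ dist x z + dist x 0 := dist_triangle_left _ _ _
  have hxB : x ∈ B := by
    have := dist_nonneg (x := x) (y := 0)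
    have := dist_nonneg (x := z₀) (y := 0)
    rw [Metric.mem_closedBall]; linarith
  have hzB : z ∈ B := by rw [Metric.mem_closedBall]; linarith
  have hlip := hC.dist_le_mul x hxB z hzB
  rw [hg z hz, Real.dist_eq, sub_zero] at hlip
  rw [hxz]
  nlinarith [dist_nonneg (x := x) (y := z)]

/-- On a compact set, the square of a smooth function is bounded by a multiple of any positive one. -/
theorem SmoothFns.exists_sq_le_mul_of_pos {n : ℕ} (f g : SmoothFns n) (hf : ∀ x, 0 < f.1 x)
    {K : Set (Fin n → ℝ)} (hK : IsCompact K) :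
    ∃ C : ℝ, 0 < C ∧ ∀ x ∈ K, g.1 x ^ 2 ≤ C * f.1 x := by
  obtain ⟨M, hM⟩ := hK.bddAbove_image (f := fun x => g.1 x ^ 2 / f.1 x)
    (((SmoothFns.contDiff g).continuous.pow 2).div (SmoothFns.contDiff f).continuous
      fun x => (hf x).ne').continuousOn
  refine ⟨max M 1, by positivity, fun x hx => ?_⟩
  rw [← div_le_iff₀ (hf x)]
  exact (hM ⟨x, hx, rfl⟩).trans (le_max_left _ _)

/-- Lemma (Łojasiewicz inequality for a Łojasiewicz ideal): if `a ⊆ E(ℝⁿ)` is a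
Łojasiewicz ideal generated by `f₁, …, f_l`, `f = f₁² + ⋯ + f_l²`, and `g ∈ E(ℝⁿ)`
vanishes on `Z(f) = Z(a)`, then on a neighborhood of any compact `K` one has
`g^(2m) ≤ c f` for some `c > 0`, `m ≥ 1`; in particular `g^(2m) ≤ |a₀|` for some
`a₀ ∈ a` on a neighborhood of `K`. -/
theorem lojasiewicz_ideal_ineq (n l : ℕ) (F : Fin l → SmoothFns n)
    (a : Ideal (SmoothFns n)) (ha : a = Ideal.span (Set.range F))
    (hLoj : ∃ f₀ ∈ a, ∀ K : Set (Fin n → ℝ), IsCompact K →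
      ∃ c : ℝ, 0 < c ∧ ∃ m : ℕ, 1 ≤ m ∧ ∃ V : Set (Fin n → ℝ), IsOpen V ∧ K ⊆ V ∧
        ∀ x ∈ V, c * Metric.infDist x {y | ∀ h ∈ a, h.1 y = 0} ^ m ≤ |f₀.1 x|)
    (f : SmoothFns n) (hf : f = ∑ i, F i * F i)
    (g : SmoothFns n) (hg : ∀ x : Fin n → ℝ, f.1 x = 0 → g.1 x = 0) :
    ∀ K : Set (Fin n → ℝ), IsCompact K →
      (∃ c : ℝ, 0 < c ∧ ∃ m : ℕ, 1 ≤ m ∧ ∃ V : Set (Fin n → ℝ), IsOpen V ∧ K ⊆ V ∧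
        ∀ x ∈ V, g.1 x ^ (2 * m) ≤ c * f.1 x) ∧
      (∃ m : ℕ, 1 ≤ m ∧ ∃ a₀ ∈ a, ∃ V : Set (Fin n → ℝ), IsOpen V ∧ K ⊆ V ∧
        ∀ x ∈ V, g.1 x ^ (2 * m) ≤ |a₀.1 x|) := by
  subst ha hf
  intro K hK
  have key : ∃ c : ℝ, 0 < c ∧ ∃ m : ℕ, 1 ≤ m ∧ ∃ V : Set (Fin n → ℝ), IsOpen V ∧ K ⊆ V ∧
      ∀ x ∈ V, g.1 x ^ (2 * m) ≤ c * (∑ i, F i * F i).1 x := by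
    obtain ⟨R, hR⟩ := hK.isBounded.subset_ball (0 : Fin n → ℝ)
    have hB := isCompact_closedBall (0 : Fin n → ℝ) R
    obtain ⟨f₀, hf₀, hf₀K⟩ := hLoj
    set Z : Set (Fin n → ℝ) := {y | ∀ h ∈ Ideal.span (Set.range F), h.1 y = 0}
    have hZf : Z = {y | (∑ i, F i * F i).1 y = 0} :=
      Set.ext fun x => (SmoothFns.sum_sq_eq_zero_iff F x).symm
    rcases Z.eq_empty_or_nonempty with hZ | hZ
    · have hpos : ∀ x, 0 < (∑ i, F i * F i).1 x := fun x => by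
        refine lt_of_le_of_ne ?_ fun h0 => ?_
        · rw [SmoothFns.sum_mul_apply]
          exact Finset.sum_nonneg fun i _ => mul_self_nonneg _
        · have hx : x ∈ Z := hZf ▸ h0.symm
          rwa [hZ] at hx
      obtain ⟨C, hC, h⟩ := SmoothFns.exists_sq_le_mul_of_pos (∑ i, F i * F i) g hpos hB
      exact ⟨C, hC, 1, le_rfl, _, Metric.isOpen_ball, hR,
        fun x hx => h x (Metric.ball_subset_closedBall hx)⟩
    · obtain ⟨c, hc, m, hm, V, hV, hKV, hfV⟩ := hf₀K K hK
      have hZc : IsClosed Z := hZf ▸ isClosed_eq (SmoothFns.contDiff _).continuous continuous_const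
      have hgZ : ∀ z ∈ Z, g.1 z = 0 := fun z hz => hg z ((SmoothFns.sum_sq_eq_zero_iff F z).2 hz)
      obtain ⟨C, hC, hgC⟩ := SmoothFns.exists_abs_le_mul_infDist g hZc hZ hgZ R
      obtain ⟨M, hM, hfM⟩ := SmoothFns.exists_sq_le_mul_sum_sq F hf₀ hB
      refine ⟨(C ^ m / c) ^ 2 * M, by positivity, m, hm, V ∩ Metric.ball 0 R,
        hV.inter Metric.isOpen_ball, Set.subset_inter hKV hR, fun x hx => ?_⟩
      have hpow : |g.1 x| ^ m ≤ C ^ m / c * |f₀.1 x| := calc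
        |g.1 x| ^ m ≤ (C * Metric.infDist x Z) ^ m :=
          pow_le_pow_left₀ (abs_nonneg _) (hgC x hx.2) m
        _ = C ^ m / c * (c * Metric.infDist x Z ^ m) := by
          rw [mul_pow]
          field_simp
        _ ≤ C ^ m / c * |f₀.1 x| := mul_le_mul_of_nonneg_left (hfV x hx.1) (by positivity)
      calc g.1 x ^ (2 * m) = (|g.1 x| ^ m) ^ 2 := by rw [pow_mul, ← sq_abs, ← pow_mul, ← pow_mul,
            mul_comm]
        _ ≤ (C ^ m / c * |f₀.1 x|) ^ 2 := pow_le_pow_left₀ (by positivity) hpow 2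
        _ = (C ^ m / c) ^ 2 * f₀.1 x ^ 2 := by rw [mul_pow, sq_abs]
        _ ≤ (C ^ m / c) ^ 2 * (M * (∑ i, F i * F i).1 x) :=
          mul_le_mul_of_nonneg_left (hfM x (Metric.ball_subset_closedBall hx.2)) (by positivity)
        _ = _ := by ring
  refine ⟨key, ?_⟩
  obtain ⟨c, -, m, hm, V, hV, hKV, h⟩ := key
  refine ⟨m, hm, c • ∑ i, F i * F i, ?_, V, hV, hKV, fun x hx => (h x hx).trans (le_abs_self _)⟩
  exact Submodule.smul_of_tower_mem _ c
    (Ideal.sum_mem _ fun i _ => Ideal.mul_mem_left _ _ (Ideal.subset_span ⟨i, rfl⟩))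
end

section
/- Let U ⊆ ℝⁿ be open, let f₁,…,f_l ∈ E(ℝⁿ), set f = f₁² + ⋯ + f_l² and let Z = {x ∈ ℝⁿ : f₁(x) = ⋯ = f_l(x) = 0}. Assume that for every compact K ⊆ U there exist a constant c > 0, a positive integer m, and an open set V with K ⊆ V ⊆ U such that f(x) ≥ c · dist(x, Z ∩ U)^m for all x ∈ V. If g ∈ E(ℝⁿ) vanishes on Z ∩ U, then for every compact K ⊆ U there exist a constant c' > 0, a positive integer m', and an open set V' with K ⊆ V' ⊆ U such that g(x)^(2m') ≤ c'·f(x) for all x ∈ V'. -/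
theorem exists_abs_le_mul_infDist_of_contDiff {E : Type*} [NormedAddCommGroup E] [NormedSpace ℝ E]
    [ProperSpace E] {g : E → ℝ} (hg : ContDiff ℝ 1 g) {A L : Set E} (hA : A.Nonempty)
    (hgA : ∀ x ∈ A, g x = 0) (hL : IsCompact L) :
    ∃ C : ℝ, 0 < C ∧ ∀ x ∈ L, |g x| ≤ C * Metric.infDist x A := by
  obtain ⟨a, ha⟩ := hA
  obtain ⟨R, hR⟩ := hL.isBounded.subset_closedBall a
  obtain ⟨C, hC⟩ := (hg.contDiffOn (s := Metric.closedBall a (2 * R))).exists_lipschitzOnWith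
    one_ne_zero (convex_closedBall a (2 * R)) (isCompact_closedBall a (2 * R))
  refine ⟨C + 1, by positivity, fun x hx => ?_⟩
  have hxR : dist x a ≤ R := hR hx
  have hRnonneg : 0 ≤ R := dist_nonneg.trans hxR
  obtain ⟨z, hz, hzx⟩ := Metric.exists_mem_closure_infDist_eq_dist ⟨a, ha⟩ x
  have hgz : g z = 0 :=
    closure_minimal (t := {y | g y = 0}) hgA (isClosed_eq hg.continuous continuous_const) hz
  have hxz : dist x z ≤ R := hzx ▸ (Metric.infDist_le_dist_of_mem ha).trans hxR
  have hza : dist z a ≤ 2 * R := by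
    linarith [dist_triangle z x a, dist_comm z x]
  have hgx := hC.dist_le_mul x (Metric.mem_closedBall.mpr (by linarith)) z hza
  rw [Real.dist_eq, hgz, sub_zero] at hgx
  rw [hzx]
  nlinarith [dist_nonneg (x := x) (y := z)]

/-- Localization to an open set `U` of the Łojasiewicz-inequality lemma: if the sum of
squares `f = f₁² + ⋯ + f_l²` satisfies a Łojasiewicz inequality with respect to
`dist(·, Z ∩ U)` near every compact subset of `U`, and `g ∈ E(ℝⁿ)` vanishes on `Z ∩ U`,
then `g^(2m') ≤ c' f` near every compact subset of `U`. -/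
theorem lojasiewicz_ideal_ineq_on_open (n l : ℕ) (U : Set (Fin n → ℝ)) (hU : IsOpen U)
    (F : Fin l → SmoothFns n) (f : SmoothFns n) (hf : f = ∑ i, F i * F i)
    (Z : Set (Fin n → ℝ)) (hZ : Z = {x | ∀ i, (F i).1 x = 0})
    (hLoj : ∀ K : Set (Fin n → ℝ), K ⊆ U → IsCompact K →
      ∃ c : ℝ, 0 < c ∧ ∃ m : ℕ, 1 ≤ m ∧ ∃ V : Set (Fin n → ℝ),
        IsOpen V ∧ K ⊆ V ∧ V ⊆ U ∧
        ∀ x ∈ V, c * Metric.infDist x (Z ∩ U) ^ m ≤ f.1 x)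
    (g : SmoothFns n) (hg : ∀ x ∈ Z ∩ U, g.1 x = 0) :
    ∀ K : Set (Fin n → ℝ), K ⊆ U → IsCompact K →
      ∃ c' : ℝ, 0 < c' ∧ ∃ m' : ℕ, 1 ≤ m' ∧ ∃ V' : Set (Fin n → ℝ),
        IsOpen V' ∧ K ⊆ V' ∧ V' ⊆ U ∧
        ∀ x ∈ V', g.1 x ^ (2 * m') ≤ c' * f.1 x := by
  intro K hKU hK
  obtain ⟨L, hL, hKL, hLU⟩ := exists_compact_between hK hU hKU
  have hfs : ContDiff ℝ (⊤ : ℕ∞) f.1 := f.2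
  have hgs : ContDiff ℝ (⊤ : ℕ∞) g.1 := g.2
  have hfx : ∀ x, f.1 x = ∑ i, (F i).1 x * (F i).1 x := by
    intro x
    rw [hf]
    simp
  have hf0 : ∀ x, 0 ≤ f.1 x := fun x =>
    hfx x ▸ Finset.sum_nonneg fun i _ => mul_self_nonneg _
  rcases (Z ∩ U).eq_empty_or_nonempty with hempty | hne
  · have hpos : ∀ x ∈ L, f.1 x ≠ 0 := by
      intro x hx h0
      rw [hfx, Finset.sum_eq_zero_iff_of_nonneg fun i _ => mul_self_nonneg _] at h0
      have hxZ : x ∈ Z ∩ U :=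
        ⟨hZ ▸ fun i => mul_self_eq_zero.mp (h0 i (Finset.mem_univ i)), hLU hx⟩
      simp [hempty] at hxZ
    obtain ⟨C, hC⟩ := hL.exists_bound_of_continuousOn
      (f := fun x => g.1 x ^ 2 / f.1 x)
      ((hgs.continuous.pow 2).continuousOn.div hfs.continuous.continuousOn hpos)
    refine ⟨max C 1, by positivity, 1, le_rfl, interior L, isOpen_interior, hKL,
      interior_subset.trans hLU, fun x hx => ?_⟩
    have hxL := interior_subset hx
    rw [mul_one, ← div_le_iff₀ ((hf0 x).lt_of_ne' (hpos x hxL))]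
    exact ((le_abs_self _).trans (hC x hxL)).trans (le_max_left _ _)
  · obtain ⟨C, hC, hgC⟩ := exists_abs_le_mul_infDist_of_contDiff
      (hgs.of_le (by exact_mod_cast le_top)) hne hg hL
    obtain ⟨B, hB⟩ := hL.exists_bound_of_continuousOn
      (f := fun x => Metric.infDist x (Z ∩ U)) (Metric.continuous_infDist_pt _).continuousOn
    obtain ⟨c, hc, m, hm, V, hV, hKV, hVU, hfV⟩ := hLoj K hKU hK
    refine ⟨C ^ (2 * m) * max B 1 ^ m / c, by positivity, m, hm, V ∩ interior L,
      hV.inter isOpen_interior, Set.subset_inter hKV hKL,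
      Set.inter_subset_left.trans hVU, fun x hx => ?_⟩
    have hxL := interior_subset hx.2
    have hd : 0 ≤ Metric.infDist x (Z ∩ U) := Metric.infDist_nonneg
    have hdB : Metric.infDist x (Z ∩ U) ≤ max B 1 :=
      ((le_abs_self _).trans (hB x hxL)).trans (le_max_left _ _)
    calc g.1 x ^ (2 * m) = |g.1 x| ^ (2 * m) := ((even_two_mul m).pow_abs _).symm
      _ ≤ (C * Metric.infDist x (Z ∩ U)) ^ (2 * m) := by gcongr; exact hgC x hxL
      _ = C ^ (2 * m) * Metric.infDist x (Z ∩ U) ^ m * Metric.infDist x (Z ∩ U) ^ m := by ring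
      _ ≤ C ^ (2 * m) * max B 1 ^ m * Metric.infDist x (Z ∩ U) ^ m := by gcongr
      _ = C ^ (2 * m) * max B 1 ^ m / c * (c * Metric.infDist x (Z ∩ U) ^ m) := by field_simp
      _ ≤ C ^ (2 * m) * max B 1 ^ m / c * f.1 x := by gcongr; exact hfV x hx.1
end

section
/- Let a ⊆ E(ℝⁿ) be a Łojasiewicz ideal. Then the saturation of the Łojasiewicz radical of a equals its Whitney closure: {g ∈ E(ℝⁿ) : for every x ∈ ℝⁿ there exists h ∈ E(ℝⁿ) with h(x) ≠ 0 and h·g ∈ √[Ł]a} = {g ∈ E(ℝⁿ) : for every x ∈ ℝⁿ there exists f ∈ √[Ł]a with iteratedFDeriv ℝ k (g − f) x = 0 for all k ≥ 0}. -/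
/-- The zero set `Z(a)` of an ideal of smooth functions. -/
def ZeroSet (n : ℕ) (a : Ideal (SmoothFns n)) : Set (Fin n → ℝ) :=
  {x | ∀ h ∈ a, h.1 x = 0}

/-- An ideal `a ⊆ E(ℝⁿ)` is a Łojasiewicz ideal if it is finitely generated and
contains an element `f` with `|f(x)| ≥ c · dist(x, Z(a))^m` near every compact set. -/
def IsLojasiewiczIdeal (n : ℕ) (a : Ideal (SmoothFns n)) : Prop :=
  (∃ l : ℕ, ∃ F : Fin l → SmoothFns n, a = Ideal.span (Set.range F)) ∧
  ∃ f ∈ a, ∀ K : Set (Fin n → ℝ), IsCompact K →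
    ∃ c : ℝ, 0 < c ∧ ∃ m : ℕ, 1 ≤ m ∧ ∃ V : Set (Fin n → ℝ), IsOpen V ∧ K ⊆ V ∧
      ∀ x ∈ V, c * Metric.infDist x (ZeroSet n a) ^ m ≤ |f.1 x|

/-- The Łojasiewicz radical `√[Ł]a` of an ideal `a ⊆ E(ℝⁿ)`. -/
def LRadical (n : ℕ) (a : Ideal (SmoothFns n)) : Set (SmoothFns n) :=
  {g | ∃ f ∈ a, ∃ m : ℕ, 1 ≤ m ∧ ∀ x : Fin n → ℝ, f.1 x - g.1 x ^ (2 * m) ≥ 0}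

/-- The zero set of an ideal of smooth functions is closed. -/
theorem isClosed_zeroSet {n : ℕ} (a : Ideal (SmoothFns n)) : IsClosed (ZeroSet n a) := by
  have hEq : ZeroSet n a = ⋂ h ∈ a, {x | h.1 x = 0} := by
    ext x
    simp [ZeroSet]
  rw [hEq]
  exact isClosed_biInter fun h _ =>
    isClosed_eq (ContDiff.continuous (n := ((⊤ : ℕ∞) : WithTop ℕ∞)) h.2) continuous_const

/-- The Łojasiewicz radical is stable under multiplication by smooth functions. -/
theorem LRadical.mul_mem_left {n : ℕ} {a : Ideal (SmoothFns n)} (u : SmoothFns n)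
    {g : SmoothFns n} (hg : g ∈ LRadical n a) : u * g ∈ LRadical n a := by
  obtain ⟨f, hf, m, hm, hle⟩ := hg
  refine ⟨u ^ (2 * m) * f, a.mul_mem_left _ hf, m, hm, fun x => ?_⟩
  have hval : (u ^ (2 * m) * f).1 x - (u * g).1 x ^ (2 * m)
      = u.1 x ^ (2 * m) * (f.1 x - g.1 x ^ (2 * m)) := by
    change u.1 x ^ (2 * m) * f.1 x - (u.1 x * g.1 x) ^ (2 * m) = _
    ring
  rw [hval]
  exact mul_nonneg (by rw [pow_mul]; positivity) (hle x)

/-- An ideal of smooth functions is contained in its Łojasiewicz radical. -/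
theorem mem_LRadical_of_mem {n : ℕ} {a : Ideal (SmoothFns n)} {g : SmoothFns n} (hg : g ∈ a) :
    g ∈ LRadical n a := by
  refine ⟨g * g, a.mul_mem_left _ hg, 1, le_rfl, fun x => ?_⟩
  change g.1 x * g.1 x - g.1 x ^ (2 * 1) ≥ 0
  exact le_of_eq (by ring)

/-- The elements of the Łojasiewicz radical vanish on the zero set of the ideal. -/
theorem LRadical.eq_zero_of_mem_zeroSet {n : ℕ} {a : Ideal (SmoothFns n)} {g : SmoothFns n}
    (hg : g ∈ LRadical n a) {x : Fin n → ℝ} (hx : x ∈ ZeroSet n a) : g.1 x = 0 := by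
  obtain ⟨f, hf, m, hm, hle⟩ := hg
  have hle := hle x
  rw [hx f hf, pow_mul] at hle
  have hnonneg : 0 ≤ (g.1 x ^ 2) ^ m := by positivity
  have hzero : (g.1 x ^ 2) ^ m = 0 := by linarith
  simpa using eq_zero_of_pow_eq_zero hzero

/-- A smooth function which does not vanish at `x` has a smooth inverse near `x`, defined on all
of `ℝⁿ`. -/
theorem SmoothFns.exists_mul_eq_one_near {n : ℕ} (h : SmoothFns n) {x : Fin n → ℝ}
    (hx : h.1 x ≠ 0) : ∃ u : SmoothFns n, ∀ᶠ y in nhds x, u.1 y * h.1 y = 1 := by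
  have hsmooth : ContDiff ℝ (⊤ : ℕ∞) h.1 := h.2
  have hne : ∀ᶠ y in nhds x, h.1 y ≠ 0 := hsmooth.continuous.continuousAt.eventually_ne hx
  obtain ⟨r, hr, hball⟩ := Metric.eventually_nhds_iff_ball.1 hne
  let φ : ContDiffBump x := ⟨r / 2, r, by positivity, by linarith⟩
  have hden : ∀ y, h.1 y ^ 2 + (1 - φ y) ≠ 0 := fun y => by
    have hφ : φ y ≤ 1 := φ.le_one
    by_cases hy : y ∈ Metric.ball x r
    · have := sq_pos_of_ne_zero (hball y hy)
      exact ne_of_gt (by linarith)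
    · have h0 : φ y = 0 := φ.zero_of_le_dist (by simpa using hy)
      rw [h0]
      positivity
  refine ⟨⟨fun y => h.1 y / (h.1 y ^ 2 + (1 - φ y)),
    show ContDiff ℝ (⊤ : ℕ∞) _ from
      hsmooth.div ((hsmooth.pow 2).add (contDiff_const.sub φ.contDiff)) hden⟩, ?_⟩
  filter_upwards [hne, φ.eventuallyEq_one] with y hy hφ
  have hφ : φ y = 1 := hφ
  change h.1 y / (h.1 y ^ 2 + (1 - φ y)) * h.1 y = 1
  rw [hφ]
  field_simp
  simp

/-- A smooth function vanishing on a closed set `Z` is, near a point of `Z`, bounded by a multiple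
of the distance to `Z`. -/
theorem SmoothFns.eventually_abs_le_infDist {n : ℕ} (g : SmoothFns n) {Z : Set (Fin n → ℝ)}
    (hZ : IsClosed Z) (hg : ∀ z ∈ Z, g.1 z = 0) {x : Fin n → ℝ} (hx : x ∈ Z) :
    ∃ C : ℝ, 0 ≤ C ∧ ∀ᶠ y in nhds x, |g.1 y| ≤ C * Metric.infDist y Z := by
  have hsmooth : ContDiff ℝ (⊤ : ℕ∞) g.1 := g.2
  obtain ⟨C, t, ht, hLip⟩ := (hsmooth.of_le (m := 1) (by simp)).contDiffAt (x := x)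
    |>.exists_lipschitzOnWith
  obtain ⟨r, hr, hball⟩ := Metric.mem_nhds_iff.1 ht
  refine ⟨C, C.2, ?_⟩
  filter_upwards [Metric.ball_mem_nhds x (half_pos hr)] with y hy
  obtain ⟨z, hz, hdist⟩ := hZ.exists_infDist_eq_dist ⟨x, hx⟩ y
  have hyx : dist y x < r / 2 := hy
  have hle := Metric.infDist_le_dist_of_mem (x := y) hx
  have hzx : dist z x < r := by
    have := dist_triangle_left z x y
    linarith
  have hbound := hLip.dist_le_mul y (hball (by simpa using hyx.trans (half_lt_self hr)))
    z (hball hzx)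
  rwa [Real.dist_eq, hg z hz, sub_zero, ← hdist] at hbound

/-- A smooth function vanishing on the zero set of a Łojasiewicz ideal belongs to the saturation
of the Łojasiewicz radical. -/
theorem IsLojasiewiczIdeal.exists_mul_mem_LRadical {n : ℕ} {a : Ideal (SmoothFns n)}
    (ha : IsLojasiewiczIdeal n a) {g : SmoothFns n} (hg : ∀ z ∈ ZeroSet n a, g.1 z = 0)
    (x : Fin n → ℝ) : ∃ h : SmoothFns n, h.1 x ≠ 0 ∧ h * g ∈ LRadical n a := by
  by_cases hx : x ∈ ZeroSet n a
  · obtain ⟨-, f, hf, hLoj⟩ := ha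
    obtain ⟨c, hc, m, hm, V, hV, hxV, hfV⟩ := hLoj {x} isCompact_singleton
    obtain ⟨C, hC, hgC⟩ := SmoothFns.eventually_abs_le_infDist g (isClosed_zeroSet a) hg hx
    obtain ⟨r, hr, hball⟩ := Metric.eventually_nhds_iff_ball.1
      (hgC.and (hV.mem_nhds (hxV rfl)))
    let φ : ContDiffBump x := ⟨r / 2, r, by positivity, by linarith⟩
    refine ⟨⟨φ, φ.contDiff⟩, ?_, ?_⟩
    · change φ x ≠ 0
      rw [φ.one_of_mem_closedBall (Metric.mem_closedBall_self φ.rIn_pos.le)]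
      exact one_ne_zero
    · refine ⟨algebraMap ℝ (SmoothFns n) ((C ^ m / c) ^ 2) * f * f, a.mul_mem_left _ hf,
        m, hm, fun y => ?_⟩
      change (C ^ m / c) ^ 2 * f.1 y * f.1 y - (φ y * g.1 y) ^ (2 * m) ≥ 0
      by_cases hy : y ∈ Metric.ball x r
      · obtain ⟨hgy, hyV⟩ := hball y hy
        have hφg : |φ y * g.1 y| ≤ C * Metric.infDist y (ZeroSet n a) := by
          rw [abs_mul, abs_of_nonneg φ.nonneg]
          exact (mul_le_of_le_one_left (abs_nonneg _) φ.le_one).trans hgy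
        have hpow : |φ y * g.1 y| ^ m ≤ C ^ m / c * |f.1 y| := by
          calc |φ y * g.1 y| ^ m ≤ (C * Metric.infDist y (ZeroSet n a)) ^ m := by gcongr
            _ = C ^ m / c * (c * Metric.infDist y (ZeroSet n a) ^ m) := by
              rw [mul_pow]
              field_simp
            _ ≤ C ^ m / c * |f.1 y| := by
              gcongr
              exact hfV y hyV
        have hsq := pow_le_pow_left₀ (by positivity) hpow 2
        rw [mul_pow, sq_abs, ← pow_mul, mul_comm m 2, pow_mul, sq_abs, ← pow_mul] at hsq
        linarith
      · have h0 : φ y = 0 := φ.zero_of_le_dist (by simpa using hy)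
        rw [h0, zero_mul, zero_pow (by omega), sub_zero, mul_assoc]
        exact mul_nonneg (sq_nonneg _) (mul_self_nonneg _)
  · obtain ⟨h, hh, hhx⟩ : ∃ h ∈ a, h.1 x ≠ 0 := by simpa [ZeroSet] using hx
    exact ⟨h, hhx, mem_LRadical_of_mem (a.mul_mem_right _ hh)⟩

/-- Theorem (a): for a Łojasiewicz ideal `a ⊆ E(ℝⁿ)`, the saturation of the
Łojasiewicz radical `√[Ł]a` equals its Whitney closure. -/
theorem saturation_LRadical_eq_whitney_closure (n : ℕ) (a : Ideal (SmoothFns n))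
    (hLoj : IsLojasiewiczIdeal n a) :
    {g : SmoothFns n | ∀ x : Fin n → ℝ, ∃ h : SmoothFns n,
        h.1 x ≠ 0 ∧ h * g ∈ LRadical n a}
      = {g : SmoothFns n | ∀ x : Fin n → ℝ, ∃ f ∈ LRadical n a,
          ∀ k : ℕ, iteratedFDeriv ℝ k (g.1 - f.1) x = 0} := by
  ext g
  constructor
  · intro hg x
    obtain ⟨h, hx, hhg⟩ := hg x
    obtain ⟨u, hu⟩ := SmoothFns.exists_mul_eq_one_near h hx
    refine ⟨u * (h * g), LRadical.mul_mem_left u hhg, fun k => ?_⟩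
    have hzero : (g.1 - (u * (h * g)).1) =ᶠ[nhds x] fun _ => 0 := by
      filter_upwards [hu] with y hy
      change g.1 y - u.1 y * (h.1 y * g.1 y) = 0
      rw [← mul_assoc, hy, one_mul, sub_self]
    rw [(Filter.EventuallyEq.iteratedFDeriv ℝ hzero k).eq_of_nhds, iteratedFDeriv_fun_zero]
    rfl
  · intro hg
    refine fun x => hLoj.exists_mul_mem_LRadical (fun z hz => ?_) x
    obtain ⟨f, hf, hflat⟩ := hg z
    have hval : g.1 z - f.1 z = 0 := by
      simpa using congrArg (fun L => L 0) (hflat 0)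
    rw [sub_eq_zero.1 hval, LRadical.eq_zero_of_mem_zeroSet hf hz]
end

section
/- Let a ⊆ E(ℝⁿ) be a Łojasiewicz ideal. Then I(Z(a)) equals the Whitney closure of the Łojasiewicz radical of a: {g ∈ E(ℝⁿ) : g vanishes identically on Z(a)} = {g ∈ E(ℝⁿ) : for every x ∈ ℝⁿ there exists f ∈ √[Ł]a with iteratedFDeriv ℝ k (g − f) x = 0 for all k ≥ 0}. -/
/-- A compactly supported smooth function is dominated by a multiple of the distance to any
nonempty set on which it vanishes. -/
lemma exists_abs_le_mul_infDist {E : Type*} [NormedAddCommGroup E] [NormedSpace ℝ E]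
    {f : E → ℝ} (hf : ContDiff ℝ (⊤ : ℕ∞) f) (hc : HasCompactSupport f) {Z : Set E}
    (hZ : Z.Nonempty) (h0 : ∀ z ∈ Z, f z = 0) :
    ∃ L : ℝ, 0 < L ∧ ∀ y, |f y| ≤ L * Metric.infDist y Z := by
  obtain ⟨C, hC⟩ := hf.lipschitzWith_of_hasCompactSupport hc (by simp)
  have hL : (0 : ℝ) < C + 1 := by positivity
  refine ⟨C + 1, hL, fun y => ?_⟩
  rw [← div_le_iff₀' hL, Metric.le_infDist hZ]
  intro z hz
  rw [div_le_iff₀' hL]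
  have h := hC.dist_le_mul y z
  rw [Real.dist_eq, h0 z hz, sub_zero] at h
  nlinarith [dist_nonneg (x := y) (y := z)]

/-- A finitely generated ideal of smooth functions without common zeros is the whole ring. -/
lemma span_range_eq_top_of_zeroSet_eq_empty {n l : ℕ} (F : Fin l → SmoothFns n)
    (hZ : ZeroSet n (Ideal.span (Set.range F)) = ∅) : Ideal.span (Set.range F) = ⊤ := by
  set s : SmoothFns n := ∑ i, F i * F i with hs
  have hsa : s ∈ Ideal.span (Set.range F) := Ideal.sum_mem _ fun i _ =>
    Ideal.mul_mem_left _ _ (Ideal.subset_span ⟨i, rfl⟩)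
  have hsx : ∀ x, s.1 x = ∑ i, (F i).1 x * (F i).1 x := fun x => by
    simp [hs, Finset.sum_apply]
  have hne : ∀ x, s.1 x ≠ 0 := by
    intro x hx
    rw [hsx, Finset.sum_eq_zero_iff_of_nonneg fun i _ => mul_self_nonneg _] at hx
    have hmem : x ∈ ZeroSet n (Ideal.span (Set.range F)) := by
      intro h hh
      induction hh using Submodule.span_induction with
      | mem h hh =>
        obtain ⟨i, rfl⟩ := hh
        exact mul_self_eq_zero.mp (hx i (Finset.mem_univ i))
      | zero => rfl
      | add u v _ _ hu hv =>
        change u.1 x + v.1 x = 0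
        rw [hu, hv, add_zero]
      | smul r u _ hu =>
        change r.1 x * u.1 x = 0
        rw [hu, mul_zero]
    simp [hZ] at hmem
  have hs_smooth : ContDiff ℝ (⊤ : ℕ∞) s.1 := s.2
  let t : SmoothFns n := ⟨fun x => (s.1 x)⁻¹, hs_smooth.inv hne⟩
  rw [Ideal.eq_top_iff_one]
  have h1 : t * s = 1 := Subtype.ext (funext fun x => inv_mul_cancel₀ (hne x))
  exact h1 ▸ Ideal.mul_mem_left _ t hsa

/-- A compactly supported smooth function vanishing on the zero set of a Łojasiewicz ideal lies
in its Łojasiewicz radical. -/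
lemma IsLojasiewiczIdeal.mem_LRadical {n : ℕ} {a : Ideal (SmoothFns n)}
    (hLoj : IsLojasiewiczIdeal n a) {f : SmoothFns n} (hc : HasCompactSupport f.1)
    (h0 : ∀ x ∈ ZeroSet n a, f.1 x = 0) : f ∈ LRadical n a := by
  obtain ⟨⟨l, F, rfl⟩, φ, hφ, hK⟩ := hLoj
  rcases (ZeroSet n (Ideal.span (Set.range F))).eq_empty_or_nonempty with hZ | hZ
  · refine ⟨f ^ 2, ?_, 1, le_rfl, fun x => ?_⟩
    · rw [span_range_eq_top_of_zeroSet_eq_empty F hZ]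
      trivial
    · exact (sub_self (f.1 x ^ 2)).ge
  · obtain ⟨L, hL, hfL⟩ := exists_abs_le_mul_infDist f.2 hc hZ h0
    obtain ⟨c, hc0, m, hm, V, -, hKV, hV⟩ := hK _ hc
    set r : ℝ := (L ^ m / c) ^ 2
    refine ⟨r • (φ * φ), ?_, m, hm, fun x => ?_⟩
    · rw [← smul_mul_assoc]
      exact Ideal.mul_mem_left _ _ hφ
    · change 0 ≤ r * (φ.1 x * φ.1 x) - f.1 x ^ (2 * m)
      by_cases hx : x ∈ tsupport f.1
      · have h1 : |f.1 x| ^ m ≤ L ^ m / c * |φ.1 x| := by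
          calc |f.1 x| ^ m
              ≤ (L * Metric.infDist x (ZeroSet n (Ideal.span (Set.range F)))) ^ m := by
                gcongr; exact hfL x
            _ = L ^ m / c * (c * Metric.infDist x (ZeroSet n (Ideal.span (Set.range F))) ^ m) := by
                rw [mul_pow]; field_simp
            _ ≤ L ^ m / c * |φ.1 x| := by gcongr; exact hV x (hKV hx)
        have h2 : (|f.1 x| ^ m) ^ 2 ≤ (L ^ m / c * |φ.1 x|) ^ 2 := by gcongr
        rw [mul_pow, sq_abs, ← pow_mul, mul_comm m 2, (even_two_mul m).pow_abs] at h2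
        rw [← pow_two]
        exact sub_nonneg.mpr h2
      · rw [image_eq_zero_of_notMem_tsupport hx, zero_pow (by lia), sub_zero]
        exact mul_nonneg (sq_nonneg _) (mul_self_nonneg _)

/-- Theorem (b): for a Łojasiewicz ideal `a ⊆ E(ℝⁿ)`, `I(Z(a))` equals the Whitney
closure of the Łojasiewicz radical `√[Ł]a`. -/
theorem vanishing_ideal_eq_whitney_closure_LRadical (n : ℕ) (a : Ideal (SmoothFns n))
    (hLoj : IsLojasiewiczIdeal n a) :
    {g : SmoothFns n | ∀ x ∈ ZeroSet n a, g.1 x = 0}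
      = {g : SmoothFns n | ∀ x : Fin n → ℝ, ∃ f ∈ LRadical n a,
          ∀ k : ℕ, iteratedFDeriv ℝ k (g.1 - f.1) x = 0} := by
  refine Set.Subset.antisymm (fun g hg x => ?_) (fun g hg x hx => ?_)
  · let χ : ContDiffBump x := default
    have hg_smooth : ContDiff ℝ (⊤ : ℕ∞) g.1 := g.2
    refine ⟨⟨χ * g.1, χ.contDiff.mul hg_smooth⟩,
      hLoj.mem_LRadical χ.hasCompactSupport.mul_right fun y hy => ?_, fun k => ?_⟩
    · change χ y * g.1 y = 0
      rw [hg y hy, mul_zero]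
    · have h : g.1 - ⇑χ * g.1 =ᶠ[nhds x] 0 := by
        filter_upwards [χ.eventuallyEq_one] with y hy
        simp [hy]
      rw [(h.iteratedFDeriv ℝ k).eq_of_nhds]
      simp
  · obtain ⟨f, ⟨h, ha, m, hm, hfm⟩, hk⟩ := hg x
    have h0 : (g.1 - f.1) x = 0 := congrArg (fun T => T 0) (hk 0)
    have hf := hfm x
    rw [hx h ha, zero_sub] at hf
    have hf0 : f.1 x ^ (2 * m) = 0 :=
      le_antisymm (by linarith) ((even_two_mul m).pow_nonneg _)
    rw [sub_eq_zero.mp h0]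
    exact eq_zero_of_pow_eq_zero hf0
end

section
/- Let a be any ideal of E(ℝⁿ). Then the following two sets coincide: {g ∈ E(ℝⁿ) : for every compact K ⊆ ℝⁿ there exists h ∈ E(ℝⁿ) with Z(h) ∩ K = ∅ and h·g ∈ a} = {g ∈ E(ℝⁿ) : for every x ∈ ℝⁿ there exists h ∈ E(ℝⁿ) with h(x) ≠ 0 and h·g ∈ a}. -/
/-- Two characterizations of the saturation of an ideal `a ⊆ E(ℝⁿ)`: requiring,
for every compact `K`, a multiplier `h` nonvanishing on `K` with `h·g ∈ a`, is the
same as requiring, for every point `x`, a multiplier `h` with `h(x) ≠ 0` and `h·g ∈ a`. -/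
theorem saturation_compact_eq_pointwise (n : ℕ) (a : Ideal (SmoothFns n)) :
    {g : SmoothFns n | ∀ K : Set (Fin n → ℝ), IsCompact K →
        ∃ h : SmoothFns n, (∀ x ∈ K, h.1 x ≠ 0) ∧ h * g ∈ a}
      = {g : SmoothFns n | ∀ x : Fin n → ℝ,
          ∃ h : SmoothFns n, h.1 x ≠ 0 ∧ h * g ∈ a} := by
  ext g
  constructor
  · intro hg x
    obtain ⟨h, hx, hmem⟩ := hg {x} isCompact_singleton
    exact ⟨h, hx x rfl, hmem⟩
  · intro hg K hK
    -- Nonnegative multipliers, positive on a given set, can be added to cover unions.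
    suffices ∃ h : SmoothFns n, (∀ x, 0 ≤ h.1 x) ∧ (∀ x ∈ K, 0 < h.1 x) ∧ h * g ∈ a by
      obtain ⟨h, -, hpos, hmem⟩ := this
      exact ⟨h, fun x hx => (hpos x hx).ne', hmem⟩
    refine hK.induction_on (p := fun s => ∃ h : SmoothFns n,
      (∀ x, 0 ≤ h.1 x) ∧ (∀ x ∈ s, 0 < h.1 x) ∧ h * g ∈ a) ?_ ?_ ?_ ?_
    · exact ⟨0, fun _ => le_rfl, fun _ hx => hx.elim, by simp⟩
    · rintro s t hst ⟨h, h0, hpos, hmem⟩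
      exact ⟨h, h0, fun x hx => hpos x (hst hx), hmem⟩
    · rintro s t ⟨h, h0, hs, hmem⟩ ⟨k, k0, kt, kmem⟩
      refine ⟨h + k, fun x => add_nonneg (h0 x) (k0 x), ?_, ?_⟩
      · rintro x (hx | hx)
        · exact add_pos_of_pos_of_nonneg (hs x hx) (k0 x)
        · exact add_pos_of_nonneg_of_pos (h0 x) (kt x hx)
      · rw [add_mul]
        exact a.add_mem hmem kmem
    · intro x _
      obtain ⟨h, hx, hmem⟩ := hg x
      have hsmooth : ContDiff ℝ (⊤ : ℕ∞) h.1 := h.2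
      have hcont : Continuous h.1 := hsmooth.continuous
      refine ⟨{y | h.1 y ≠ 0}, mem_nhdsWithin_of_mem_nhds
        ((isOpen_ne_fun hcont continuous_const).mem_nhds hx), h * h,
        fun y => mul_self_nonneg (h.1 y), fun y hy => mul_self_pos.2 hy, ?_⟩
      rw [mul_assoc]
      exact a.mul_mem_left h hmem
end

section
/- Let a be any ideal of E(ℝⁿ) and let g ∈ E(ℝⁿ). Then the germ of g at every point belongs to the ideal generated by a in the ring of smooth germs if and only if g belongs to the pointwise saturation of a; that is: (for every x ∈ ℝⁿ there exist an open set V ∋ x, finitely many f₁,…,f_k ∈ a and smooth functions h₁,…,h_k ∈ E(ℝⁿ) such that g(y) = h₁(y)f₁(y) + ⋯ + h_k(y)f_k(y) for all y ∈ V) if and only if (for every x ∈ ℝⁿ there exists h ∈ E(ℝⁿ) with h(x) ≠ 0 and h·g ∈ a). -/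
namespace SmoothFns

theorem exists_ne_zero_support_subset {n : ℕ} {V : Set (Fin n → ℝ)} (hV : IsOpen V)
    {x : Fin n → ℝ} (hx : x ∈ V) :
    ∃ b : SmoothFns n, b.1 x ≠ 0 ∧ Function.support b.1 ⊆ V := by
  obtain ⟨f, hsupp, -, hf, -, hfx⟩ :=
    exists_contDiff_tsupport_subset (n := ⊤) (hV.mem_nhds hx)
  exact ⟨⟨f, hf⟩, by simp [hfx], (subset_tsupport f).trans hsupp⟩

/-- A smooth function that does not vanish at `x` is invertible near `x`, with an inverse
that is the restriction of a globally defined smooth function. -/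
theorem exists_local_inverse {n : ℕ} (h : SmoothFns n) {x : Fin n → ℝ} (hx : h.1 x ≠ 0) :
    ∃ V : Set (Fin n → ℝ), IsOpen V ∧ x ∈ V ∧ ∃ u : SmoothFns n, ∀ y ∈ V, u.1 y * h.1 y = 1 := by
  have hh : ContDiff ℝ (⊤ : ℕ∞) h.1 := h.2
  obtain ⟨ε, hε, hball⟩ := Metric.isOpen_iff.1 (hh.continuous.isOpen_preimage _ isOpen_ne) x hx
  let b : ContDiffBump x := ⟨ε / 2, ε, half_pos hε, half_lt_self hε⟩
  have hden (y : Fin n → ℝ) : h.1 y ^ 2 + (1 - b y) ≠ 0 := by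
    by_cases hy : y ∈ Metric.ball x ε
    · have hy0 : h.1 y ≠ 0 := hball hy
      have := b.le_one (x := y)
      exact (add_pos_of_pos_of_nonneg (by positivity) (sub_nonneg.2 this)).ne'
    · have : b y = 0 := b.zero_of_le_dist (by simpa using hy)
      rw [this]
      positivity
  refine ⟨Metric.ball x (ε / 2), Metric.isOpen_ball, Metric.mem_ball_self (half_pos hε),
    ⟨fun y => h.1 y / (h.1 y ^ 2 + (1 - b y)),
      show ContDiff ℝ (⊤ : ℕ∞) _ from
        hh.div ((hh.pow 2).add (contDiff_const.sub b.contDiff)) hden⟩, fun y hy => ?_⟩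
  have hb : b y = 1 := b.one_of_mem_closedBall (Metric.ball_subset_closedBall hy)
  have hy0 : h.1 y ≠ 0 := hball (Metric.ball_subset_ball (half_le_self hε.le) hy)
  simp only [hb]
  field_simp
  simp

end SmoothFns

/-- The germ of `g` at every point lies in the ideal generated by `a` in the ring of
smooth germs (i.e. near every point `g = h₁f₁ + ⋯ + h_k f_k` with `fᵢ ∈ a`, `hᵢ`
smooth) if and only if `g` belongs to the pointwise saturation of `a`. -/
theorem germ_mem_iff_pointwise_saturation (n : ℕ) (a : Ideal (SmoothFns n))
    (g : SmoothFns n) :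
    (∀ x : Fin n → ℝ, ∃ V : Set (Fin n → ℝ), IsOpen V ∧ x ∈ V ∧
        ∃ k : ℕ, ∃ f : Fin k → SmoothFns n, (∀ i, f i ∈ a) ∧
          ∃ h : Fin k → SmoothFns n,
            ∀ y ∈ V, g.1 y = ∑ i, (h i).1 y * (f i).1 y)
      ↔ (∀ x : Fin n → ℝ, ∃ h : SmoothFns n, h.1 x ≠ 0 ∧ h * g ∈ a) := by
  constructor
  · intro H x
    obtain ⟨V, hV, hx, k, f, hf, h, hg⟩ := H x
    obtain ⟨b, hbx, hb⟩ := SmoothFns.exists_ne_zero_support_subset hV hx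
    refine ⟨b, hbx, ?_⟩
    have hsum : b * g = b * ∑ i, h i * f i := by
      apply Subtype.ext
      funext y
      change b.1 y * g.1 y = b.1 y * (∑ i, h i * f i : SmoothFns n).1 y
      by_cases hy : b.1 y = 0
      · simp [hy]
      · rw [hg y (hb hy)]
        simp
    rw [hsum]
    exact a.mul_mem_left _ (a.sum_mem fun i _ => a.mul_mem_left _ (hf i))
  · intro H x
    obtain ⟨h, hx, hg⟩ := H x
    obtain ⟨V, hV, hxV, u, hu⟩ := SmoothFns.exists_local_inverse h hx
    refine ⟨V, hV, hxV, 1, fun _ => h * g, fun _ => hg, fun _ => u, fun y hy => ?_⟩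
    rw [Fin.sum_univ_one]
    change g.1 y = u.1 y * (h.1 y * g.1 y)
    rw [← mul_assoc, hu y hy, one_mul]
end

section
/- Let a be any ideal of E(ℝⁿ) and let (√[Ł]a)_K := {g ∈ E(ℝⁿ) : for every compact K ⊆ ℝⁿ there exist f ∈ a and an integer m ≥ 1 with f(x) − g(x)^(2m) ≥ 0 for all x ∈ K}. Then (√[Ł]a)_K is saturated: if g ∈ E(ℝⁿ) is such that for every x ∈ ℝⁿ there exists h ∈ E(ℝⁿ) with h(x) ≠ 0 and h·g ∈ (√[Ł]a)_K, then g ∈ (√[Ł]a)_K. -/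
/-- The Łojasiewicz radical computed on all compact subsets, `(√[Ł]a)_K`, is saturated:
if for every point `x` there is `h` with `h(x) ≠ 0` and `h·g ∈ (√[Ł]a)_K`,
then `g ∈ (√[Ł]a)_K`. -/
theorem compact_LRadical_saturated (n : ℕ) (a : Ideal (SmoothFns n)) (g : SmoothFns n)
    (hg : ∀ x : Fin n → ℝ, ∃ h : SmoothFns n, h.1 x ≠ 0 ∧
      (∀ K : Set (Fin n → ℝ), IsCompact K →
        ∃ f ∈ a, ∃ m : ℕ, 1 ≤ m ∧ ∀ x' ∈ K, f.1 x' - (h * g).1 x' ^ (2 * m) ≥ 0)) :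
    ∀ K : Set (Fin n → ℝ), IsCompact K →
      ∃ f ∈ a, ∃ m : ℕ, 1 ≤ m ∧ ∀ x ∈ K, f.1 x - g.1 x ^ (2 * m) ≥ 0 := by
  intro K hK
  have hglue : ∃ f ∈ a, ∃ m : ℕ, 1 ≤ m ∧ (∀ x ∈ K, 0 ≤ f.1 x) ∧
      ∀ x ∈ K ∩ K, g.1 x ^ (2 * m) ≤ f.1 x := by
    refine hK.induction_on (p := fun s => ∃ f ∈ a, ∃ m : ℕ, 1 ≤ m ∧ (∀ x ∈ K, 0 ≤ f.1 x) ∧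
      ∀ x ∈ s ∩ K, g.1 x ^ (2 * m) ≤ f.1 x) ?_ ?_ ?_ ?_
    · exact ⟨0, a.zero_mem, 1, le_rfl, fun x _ => le_rfl, by simp⟩
    · rintro s t hst ⟨f, hf, m, hm, hpos, hle⟩
      exact ⟨f, hf, m, hm, hpos, fun x hx => hle x ⟨hst hx.1, hx.2⟩⟩
    · rintro s t ⟨f₁, hf₁, m₁, hm₁, hpos₁, hle₁⟩ ⟨f₂, hf₂, m₂, hm₂, hpos₂, hle₂⟩
      have hg₁ : ∀ x, 0 ≤ g.1 x ^ (2 * m₁) := fun x => (even_two_mul m₁).pow_nonneg _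
      have hg₂ : ∀ x, 0 ≤ g.1 x ^ (2 * m₂) := fun x => (even_two_mul m₂).pow_nonneg _
      have hval : ∀ x, (g ^ (2 * m₂) * f₁ + g ^ (2 * m₁) * f₂).1 x =
          g.1 x ^ (2 * m₂) * f₁.1 x + g.1 x ^ (2 * m₁) * f₂.1 x := fun x => rfl
      have hsplit : ∀ x, g.1 x ^ (2 * (m₁ + m₂)) = g.1 x ^ (2 * m₁) * g.1 x ^ (2 * m₂) :=
        fun x => by rw [mul_add, pow_add]
      refine ⟨g ^ (2 * m₂) * f₁ + g ^ (2 * m₁) * f₂,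
        a.add_mem (a.mul_mem_left _ hf₁) (a.mul_mem_left _ hf₂), m₁ + m₂, by lia,
        fun x hx => ?_, ?_⟩
      · rw [hval]
        exact add_nonneg (mul_nonneg (hg₂ x) (hpos₁ x hx)) (mul_nonneg (hg₁ x) (hpos₂ x hx))
      · rintro x ⟨hx | hx, hxK⟩
        · rw [hval, hsplit]
          nlinarith [mul_le_mul_of_nonneg_left (hle₁ x ⟨hx, hxK⟩) (hg₂ x),
            mul_nonneg (hg₁ x) (hpos₂ x hxK)]
        · rw [hval, hsplit]
          nlinarith [mul_le_mul_of_nonneg_left (hle₂ x ⟨hx, hxK⟩) (hg₁ x),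
            mul_nonneg (hg₂ x) (hpos₁ x hxK)]
    · intro x hx
      obtain ⟨h, hhx, hh⟩ := hg x
      obtain ⟨f, hf, m, hm, hle⟩ := hh K hK
      have hpow : 0 < h.1 x ^ (2 * m) := (even_two_mul m).pow_pos hhx
      have hcont : Continuous fun y => h.1 y ^ (2 * m) :=
        (ContDiff.continuous (𝕜 := ℝ) (n := (⊤ : ℕ∞)) h.2).pow _
      have hev : ∀ᶠ y in nhds x, h.1 x ^ (2 * m) / 2 < h.1 y ^ (2 * m) :=
        hcont.continuousAt.eventually_const_lt (half_lt_self hpow)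
      have hle' : ∀ y ∈ K, h.1 y ^ (2 * m) * g.1 y ^ (2 * m) ≤ f.1 y := fun y hy => by
        rw [← mul_pow]
        exact sub_nonneg.1 (hle y hy)
      have hc : 0 < h.1 x ^ (2 * m) / 2 := half_pos hpow
      generalize h.1 x ^ (2 * m) / 2 = c at hev hc
      have hval : ∀ y, (algebraMap ℝ (SmoothFns n) c⁻¹ * f).1 y = c⁻¹ * f.1 y := fun y => rfl
      have hgm : ∀ y, 0 ≤ g.1 y ^ (2 * m) := fun y => (even_two_mul m).pow_nonneg _
      refine ⟨_, mem_nhdsWithin_of_mem_nhds hev, algebraMap ℝ (SmoothFns n) c⁻¹ * f,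
        a.mul_mem_left _ hf, m, hm, fun y hy => ?_, fun y hy => ?_⟩
      · rw [hval]
        exact mul_nonneg (inv_nonneg.2 hc.le)
          ((mul_nonneg ((even_two_mul m).pow_nonneg _) (hgm y)).trans (hle' y hy))
      · rw [hval, le_inv_mul_iff₀ hc]
        exact (mul_le_mul_of_nonneg_right (le_of_lt hy.1) (hgm y)).trans (hle' y hy.2)
  obtain ⟨f, hf, m, hm, -, hle⟩ := hglue
  exact ⟨f, hf, m, hm, fun x hx => sub_nonneg.2 (hle x ⟨hx, hx⟩)⟩
end
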